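/- arXiv:2304.01758 — 6 statements merged into one kernel-verified Lean document; each statement's English description precedes it below -/
import Mathlib

section
/- Let I : S² → ℝ be continuous and let η : ℝ → ℝ be a differentiable strictly convex function. If the entropy dissipation term vanishes, i.e. ∫_{S²}∫_{S²} [η'(I(Ω')) − η'(I(Ω))]·I(Ω) dΩ' dΩ = 0, then I is isotropic: I(Ω) = (1/(4π))·∫_{S²} I(Ω') dΩ' for every Ω ∈ S². -/
open MeasureTheory Metric Matrix

/-- The unit sphere `S²` in euclidean space `ℝ³`. -/
abbrev S2 : Set (EuclideanSpace ℝ (Fin 3)) := Metric.sphere (0 : EuclideanSpace ℝ (Fin 3)) 1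

/-- The surface measure on the unit sphere `S² ⊂ ℝ³` (total mass `4π`). -/
noncomputable def sphereMeasure : Measure S2 :=
  (volume : Measure (EuclideanSpace ℝ (Fin 3))).toSphere

/-- for a differentiable strictly convex entropy `η`, if the entropy
dissipation term vanishes, then `I` is isotropic:
`I(Ω) = (1/(4π))·∫_{S²} I(Ω') dΩ'` for every `Ω ∈ S²` (here `p.1 = Ω`, `p.2 = Ω'`). -/
theorem entropy_dissipation_eq_zero_isotropic (I : S2 → ℝ) (hI : Continuous I)
    (η : ℝ → ℝ) (hη : Differentiable ℝ η) (hconv : StrictConvexOn ℝ Set.univ η)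
    (hzero : ∫ p : S2 × S2, (deriv η (I p.2) - deriv η (I p.1)) * I p.1
        ∂(sphereMeasure.prod sphereMeasure) = 0) :
    ∀ Ω : S2, I Ω = (1 / (4 * Real.pi)) * ∫ Ω', I Ω' ∂sphereMeasure := by
  have : IsFiniteMeasure sphereMeasure := by unfold sphereMeasure; infer_instance
  have : sphereMeasure.IsOpenPosMeasure := by unfold sphereMeasure; infer_instance
  have hmono : StrictMono (deriv η) := by
    have h := hconv.strictMonoOn_deriv (fun x _ => hη x)
    exact fun a b hab => h (Set.mem_univ a) (Set.mem_univ b) hab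
  obtain ⟨M, hM⟩ : ∃ M, ∀ x, |I x| ≤ M := by
    obtain ⟨M, hM⟩ := isCompact_univ.exists_bound_of_continuousOn hI.continuousOn
    exact ⟨M, fun x => by simpa using hM x (Set.mem_univ x)⟩
  have hK : ∀ x, |deriv η (I x)| ≤ |deriv η M| + |deriv η (-M)| := by
    intro x
    have h1 := hmono.monotone (abs_le.1 (hM x)).1
    have h2 := hmono.monotone (abs_le.1 (hM x)).2
    rw [abs_le]
    constructor
    · linarith [neg_abs_le (deriv η (-M)), abs_nonneg (deriv η M)]
    · linarith [le_abs_self (deriv η M), abs_nonneg (deriv η (-M))]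
  have hIm : Measurable I := hI.measurable
  have hdm : Measurable (deriv η) := hmono.monotone.measurable
  set F : S2 × S2 → ℝ := fun p => (deriv η (I p.2) - deriv η (I p.1)) * I p.1 with hF
  have hFm : Measurable F := by
    have h1 : Measurable fun p : S2 × S2 => I p.1 := hIm.comp measurable_fst
    have h2 : Measurable fun p : S2 × S2 => I p.2 := hIm.comp measurable_snd
    exact ((hdm.comp h2).sub (hdm.comp h1)).mul h1
  have hFi : Integrable F (sphereMeasure.prod sphereMeasure) := by
    refine Integrable.of_bound hFm.aestronglyMeasurable
      ((2 * (|deriv η M| + |deriv η (-M)|)) * M) (Filter.Eventually.of_forall fun p => ?_)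
    rw [Real.norm_eq_abs, hF, abs_mul]
    refine mul_le_mul ?_ (hM _) (abs_nonneg _) (by positivity)
    have := abs_sub (deriv η (I p.2)) (deriv η (I p.1))
    linarith [hK p.1, hK p.2]
  have hFs : Integrable (fun p : S2 × S2 => F p.swap) (sphereMeasure.prod sphereMeasure) :=
    hFi.swap
  have hs : ∫ p, F p.swap ∂(sphereMeasure.prod sphereMeasure) = 0 :=
    (integral_prod_swap F).trans hzero
  have hsum : ∫ p, -(F p + F p.swap) ∂(sphereMeasure.prod sphereMeasure) = 0 := by
    rw [integral_neg, integral_add hFi hFs, hs, hzero]; simp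
  have hid : ∀ p : S2 × S2, -(F p + F p.swap)
      = (deriv η (I p.2) - deriv η (I p.1)) * (I p.2 - I p.1) := by
    intro p; simp only [hF, Prod.fst_swap, Prod.snd_swap]; ring
  have hpos : ∀ a b : ℝ, a ≠ b → 0 < (deriv η b - deriv η a) * (b - a) := by
    intro a b hab
    rcases lt_or_gt_of_ne hab with h | h
    · exact mul_pos (sub_pos.2 (hmono h)) (sub_pos.2 h)
    · exact mul_pos_of_neg_of_neg (sub_neg.2 (hmono h)) (sub_neg.2 h)
  have hae : (fun p : S2 × S2 => -(F p + F p.swap)) =ᵐ[sphereMeasure.prod sphereMeasure] 0 := by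
    refine (integral_eq_zero_iff_of_nonneg (fun p => ?_) (hFi.add hFs).neg).1 hsum
    show 0 ≤ -(F p + F p.swap)
    rw [hid]
    by_cases h : I p.1 = I p.2
    · simp [h]
    · exact (hpos _ _ h).le
  have hae2 : (fun p : S2 × S2 => I p.1) =ᵐ[sphereMeasure.prod sphereMeasure]
      (fun p => I p.2) := by
    filter_upwards [hae] with p hp
    by_contra h
    have h2 := hpos _ _ h
    rw [← hid] at h2
    exact h2.ne' hp
  have heq := Measure.eq_of_ae_eq hae2 (hI.comp continuous_fst) (hI.comp continuous_snd)
  intro Ω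
  have hc : ∀ Ω', I Ω' = I Ω := fun Ω' => congrFun heq (Ω', Ω)
  have hvol : sphereMeasure.real Set.univ = 4 * Real.pi := by
    unfold sphereMeasure
    rw [Measure.toSphere_real_apply_univ, measureReal_def, EuclideanSpace.volume_ball_fin_three]
    have hp : (0 : ℝ) ≤ Real.pi * 4 / 3 := by positivity
    simp
    rw [ENNReal.toReal_ofReal hp]
    ring
  simp_rw [hc]
  rw [integral_const, hvol, smul_eq_mul]
  field_simp
end

section
/- Let r ≥ 1, let m₁, …, m_r : S² → ℝ be continuous functions such that every nontrivial linear combination b·m (with b ≠ 0 in ℝ^r) vanishes only on a set of surface measure zero, and let K be an odd positive integer. Define the moment map M : ℝ^r → ℝ^r by M(λ)ᵢ = ∫_{S²} mᵢ(Ω)·(1 + (λ·m(Ω))/K)^K dΩ. Then M is strictly monotone: for all λ₁ ≠ λ₂ in ℝ^r, (λ₁ − λ₂)·(M(λ₁) − M(λ₂)) > 0. -/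
open MeasureTheory Metric Matrix

/-- The moment map of the `β_K` closure:
`M(λ)ᵢ = ∫_{S²} mᵢ(Ω)·(1 + (λ·m(Ω))/K)^K dΩ`. -/
noncomputable def momentMap (r K : ℕ) (m : Fin r → S2 → ℝ) (lam : Fin r → ℝ) :
    Fin r → ℝ :=
  fun i => ∫ Ω, m i Ω * (1 + (∑ j, lam j * m j Ω) / (K : ℝ)) ^ K ∂sphereMeasure

/-- the moment map of the `β_K` closure is strictly monotone:
`(λ₁ − λ₂)·(M(λ₁) − M(λ₂)) > 0` whenever `λ₁ ≠ λ₂`. -/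
theorem momentMap_strictMono (r : ℕ) (hr : 1 ≤ r)
    (m : Fin r → S2 → ℝ) (hm : ∀ i, Continuous (m i))
    (hindep : ∀ b : Fin r → ℝ, b ≠ 0 →
      sphereMeasure {Ω : S2 | ∑ i, b i * m i Ω = 0} = 0)
    (K : ℕ) (hK : Odd K) (hKpos : 0 < K) :
    ∀ lam₁ lam₂ : Fin r → ℝ, lam₁ ≠ lam₂ →
      0 < (lam₁ - lam₂) ⬝ᵥ (momentMap r K m lam₁ - momentMap r K m lam₂) := by
  intro l₁ l₂ hne
  have hfin : IsFiniteMeasure sphereMeasure := by unfold sphereMeasure; infer_instance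
  have hne0 : sphereMeasure ≠ 0 := by
    unfold sphereMeasure
    exact Measure.toSphere_ne_zero _
  have hint : ∀ f : S2 → ℝ, Continuous f → Integrable f sphereMeasure := fun f hf =>
    hf.integrable_of_hasCompactSupport (HasCompactSupport.of_compactSpace f)
  have hs : ∀ l : Fin r → ℝ, Continuous (fun Ω => ∑ j, l j * m j Ω) := fun l => by fun_prop
  have hp : ∀ l : Fin r → ℝ,
      Continuous (fun Ω => (1 + (∑ j, l j * m j Ω) / (K : ℝ)) ^ K) := fun l => by fun_prop
  have hK0 : (0 : ℝ) < K := by exact_mod_cast hKpos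
  have key : (l₁ - l₂) ⬝ᵥ (momentMap r K m l₁ - momentMap r K m l₂) =
      ∫ Ω, (∑ j, l₁ j * m j Ω - ∑ j, l₂ j * m j Ω) *
        ((1 + (∑ j, l₁ j * m j Ω) / (K : ℝ)) ^ K
          - (1 + (∑ j, l₂ j * m j Ω) / (K : ℝ)) ^ K) ∂sphereMeasure := by
    simp only [dotProduct, Pi.sub_apply, momentMap]
    have h1 : ∀ i, (l₁ i - l₂ i) *
        ((∫ Ω, m i Ω * (1 + (∑ j, l₁ j * m j Ω) / (K : ℝ)) ^ K ∂sphereMeasure)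
          - ∫ Ω, m i Ω * (1 + (∑ j, l₂ j * m j Ω) / (K : ℝ)) ^ K ∂sphereMeasure) =
        ∫ Ω, (l₁ i - l₂ i) * (m i Ω * (1 + (∑ j, l₁ j * m j Ω) / (K : ℝ)) ^ K
          - m i Ω * (1 + (∑ j, l₂ j * m j Ω) / (K : ℝ)) ^ K) ∂sphereMeasure := by
      intro i
      rw [integral_const_mul, integral_sub]
      · exact hint _ ((hm i).mul (hp l₁))
      · exact hint _ ((hm i).mul (hp l₂))
    rw [Finset.sum_congr rfl (fun i _ => h1 i), ← integral_finsetSum]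
    · congr 1
      funext Ω
      rw [← Finset.sum_sub_distrib, Finset.sum_mul]
      exact Finset.sum_congr rfl (fun i _ => by ring)
    · intro i _
      exact hint _ (continuous_const.mul (((hm i).mul (hp l₁)).sub ((hm i).mul (hp l₂))))
  rw [key]
  have hpos : ∀ a b : ℝ, a ≠ b →
      0 < (a - b) * ((1 + a / (K : ℝ)) ^ K - (1 + b / (K : ℝ)) ^ K) := by
    intro a b hab
    rcases lt_or_gt_of_ne hab with h | h
    · have : 1 + a / (K : ℝ) < 1 + b / (K : ℝ) := by gcongr
      have := hK.strictMono_pow (R := ℝ) this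
      exact mul_pos_of_neg_of_neg (by linarith) (sub_neg.2 this)
    · have : 1 + b / (K : ℝ) < 1 + a / (K : ℝ) := by gcongr
      have := hK.strictMono_pow (R := ℝ) this
      exact mul_pos (by linarith) (sub_pos.2 this)
  rw [integral_pos_iff_support_of_nonneg]
  · rw [pos_iff_ne_zero]
    intro h0
    apply hne0
    rw [← Measure.measure_univ_eq_zero]
    refine measure_mono_null ?_ (measure_union_null h0 (hindep (l₁ - l₂) (sub_ne_zero.2 hne)))
    intro Ω _
    by_cases h : ∑ j, l₁ j * m j Ω = ∑ j, l₂ j * m j Ω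
    · right
      simp [sub_mul, Finset.sum_sub_distrib, h]
    · left
      exact (hpos _ _ h).ne'
  · intro Ω
    by_cases h : ∑ j, l₁ j * m j Ω = ∑ j, l₂ j * m j Ω
    · simp [h]
    · exact (hpos _ _ h).le
  · exact hint _ (((hs l₁).sub (hs l₂)).mul ((hp l₁).sub (hp l₂)))
end

section
/- Let r ≥ 1, let m₁, …, m_r : S² → ℝ be continuous functions such that every nontrivial linear combination b·m (with b ≠ 0 in ℝ^r) vanishes only on a set of surface measure zero, and let K be an odd positive integer. Then the moment map M : ℝ^r → ℝ^r defined by M(λ)ᵢ = ∫_{S²} mᵢ(Ω)·(1 + (λ·m(Ω))/K)^K dΩ is injective. -/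
open MeasureTheory Metric Matrix

/-- the moment map of the `β_K` closure is injective. -/
theorem momentMap_injective (r : ℕ) (hr : 1 ≤ r)
    (m : Fin r → S2 → ℝ) (hm : ∀ i, Continuous (m i))
    (hindep : ∀ b : Fin r → ℝ, b ≠ 0 →
      sphereMeasure {Ω : S2 | ∑ i, b i * m i Ω = 0} = 0)
    (K : ℕ) (hK : Odd K) (hKpos : 0 < K) :
    Function.Injective (momentMap r K m) := by
  haveI : IsFiniteMeasure sphereMeasure := by unfold sphereMeasure; infer_instance
  have hne : sphereMeasure ≠ 0 := by unfold sphereMeasure; exact Measure.toSphere_ne_zero _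
  intro a c hac
  by_contra hne'
  have hb : a - c ≠ 0 := sub_ne_zero.mpr hne'
  have hKR : (0 : ℝ) < K := by exact_mod_cast hKpos
  have hint : ∀ f : S2 → ℝ, Continuous f → Integrable f sphereMeasure := fun f hf =>
    hf.integrable_of_hasCompactSupport (HasCompactSupport.of_compactSpace f)
  set F : (Fin r → ℝ) → S2 → ℝ := fun l Ω => (1 + (∑ j, l j * m j Ω) / (K : ℝ)) ^ K with hF
  have hFc : ∀ l, Continuous (F l) := fun l => by fun_prop
  set g : S2 → ℝ := fun Ω => (∑ i, (a - c) i * m i Ω) * (F a Ω - F c Ω) with hg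
  have hgc : Continuous g := by fun_prop
  have hsum : ∀ Ω, ∑ i, (a - c) i * m i Ω = ∑ i, a i * m i Ω - ∑ i, c i * m i Ω := fun Ω => by
    simp [sub_mul, Finset.sum_sub_distrib]
  have hmono : StrictMono (fun x : ℝ => (1 + x / (K : ℝ)) ^ K) := by
    intro x y hxy
    exact hK.strictMono_pow (by simpa using div_lt_div_of_pos_right hxy hKR)
  have hg0 : ∀ Ω, 0 ≤ g Ω := fun Ω => by
    simp only [hg, hsum, hF]
    rcases le_total (∑ i, a i * m i Ω) (∑ i, c i * m i Ω) with h | h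
    · exact mul_nonneg_of_nonpos_of_nonpos (sub_nonpos.mpr h) (sub_nonpos.mpr (hmono.monotone h))
    · exact mul_nonneg (sub_nonneg.mpr h) (sub_nonneg.mpr (hmono.monotone h))
  have hgint : ∫ Ω, g Ω ∂sphereMeasure = 0 := by
    have h1 : ∀ Ω, g Ω = ∑ i, (a - c) i * (m i Ω * F a Ω - m i Ω * F c Ω) := fun Ω => by
      simp only [hg, Finset.sum_mul]
      exact Finset.sum_congr rfl fun i _ => by ring
    simp_rw [h1]
    rw [integral_finsetSum _ (fun i _ => hint _ (by fun_prop))]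
    refine Finset.sum_eq_zero fun i _ => ?_
    rw [integral_const_mul, integral_sub (hint _ (by fun_prop)) (hint _ (by fun_prop))]
    have := congrFun hac i
    simp only [momentMap] at this
    simp only [hF, this, sub_self, mul_zero]
  have hae := (integral_eq_zero_iff_of_nonneg hg0 (hint g hgc)).mp hgint
  have hae2 : ∀ᵐ Ω ∂sphereMeasure, ¬ (∑ i, (a - c) i * m i Ω = 0) := by
    rw [ae_iff]; simpa only [not_not] using hindep _ hb
  have hfalse : ∀ᵐ Ω ∂sphereMeasure, False := by
    filter_upwards [hae, hae2] with Ω h1 h2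
    rcases mul_eq_zero.mp h1 with h | h
    · exact h2 h
    · exact h2 (by rw [hsum, sub_eq_zero]; exact hmono.injective (sub_eq_zero.mp h))
  apply hne
  rw [← ae_eq_bot]
  exact Filter.eventually_false_iff_eq_bot.mp hfalse
end

section
/- Let r ≥ 1, let K be an odd positive integer, and let m₁, …, m_r : S² → ℝ be continuous functions such that every nontrivial linear combination b·m (with b ≠ 0) vanishes only on a set of surface measure zero. Then the moment map M : ℝ^r → ℝ^r defined by M(λ)ᵢ = ∫_{S²} mᵢ(Ω)·(1 + (λ·m(Ω))/K)^K dΩ is continuous and injective, and consequently its range M(ℝ^r) is an open subset of ℝ^r. -/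
open MeasureTheory Metric Matrix

lemma aux_pow (n : ℕ) (hn : Odd n) (u v : ℝ) (h : u ≠ v) :
    ((n:ℝ)+1) * u ^ n * (v - u) < v ^ (n+1) - u ^ (n+1) := by
  have hc : StrictConvexOn ℝ Set.univ (fun x : ℝ => x ^ (n+1)) :=
    Even.strictConvexOn_pow (by exact hn.add_one) (by omega)
  have hd : HasDerivAt (fun x : ℝ => x ^ (n+1)) (((n:ℝ)+1) * u ^ n) u := by
    simpa using hasDerivAt_pow (n+1) u
  rcases lt_or_gt_of_ne h with h | h
  · have := hc.lt_slope_of_hasDerivAt (Set.mem_univ u) (Set.mem_univ v) h hd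
    rw [slope_def_field, lt_div_iff₀ (by linarith)] at this
    exact this
  · have := hc.slope_lt_of_hasDerivAt (Set.mem_univ v) (Set.mem_univ u) h hd
    rw [slope_def_field, div_lt_iff₀ (by linarith)] at this
    linarith

lemma aux_inj {r : ℕ} (F : (Fin r → ℝ) → ℝ) (M : (Fin r → ℝ) → (Fin r → ℝ))
    (h : ∀ a b, a ≠ b → F a + M a ⬝ᵥ (b - a) < F b) : Function.Injective M := by
  intro a b hab
  by_contra hne
  have h1 := h a b hne
  have h2 := h b a (Ne.symm hne)
  rw [hab] at h1
  simp only [dotProduct_sub] at h1 h2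
  linarith

lemma aux_open {r : ℕ} (F : (Fin r → ℝ) → ℝ) (M : (Fin r → ℝ) → (Fin r → ℝ))
    (hF : Continuous F) (hM : Continuous M)
    (h : ∀ a b, a ≠ b → F a + M a ⬝ᵥ (b - a) < F b) : IsOpen (Set.range M) := by
  rw [isOpen_iff_mem_nhds]
  rintro _ ⟨a, rfl⟩
  have hS : IsCompact (Metric.sphere a 1) := isCompact_sphere a 1
  have hGc : Continuous (fun μ => F μ - F a - M a ⬝ᵥ (μ - a)) := by
    unfold dotProduct
    fun_prop
  obtain ⟨c, hc, hcS⟩ : ∃ c > 0, ∀ μ ∈ Metric.sphere a 1, c ≤ F μ - F a - M a ⬝ᵥ (μ - a) := by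
    obtain ⟨c, hc, hcS⟩ := hS.exists_forall_le' hGc.continuousOn (a := 0) (by
      intro μ hμ
      have : a ≠ μ := by
        rintro rfl
        simp at hμ
      have := h a μ this
      linarith)
    exact ⟨c, hc, hcS⟩
  have hN : {y : Fin r → ℝ | ∑ i, |y i - M a i| < c} ∈ nhds (M a) := by
    apply IsOpen.mem_nhds
    · exact isOpen_lt (by fun_prop) continuous_const
    · simpa using hc
  filter_upwards [hN] with y hy
  have hy : ∑ i, |y i - M a i| < c := hy
  have hHc : Continuous (fun μ => F μ - y ⬝ᵥ μ) := by
    unfold dotProduct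
    fun_prop
  obtain ⟨l, hl, hmin⟩ := (isCompact_closedBall a 1).exists_isMinOn
    ⟨a, by simp⟩ hHc.continuousOn
  have hlb : l ∈ Metric.ball a 1 := by
    by_contra hnb
    have hls : l ∈ Metric.sphere a 1 := by
      simp only [Metric.mem_ball, Metric.mem_closedBall, Metric.mem_sphere] at *
      linarith
    have h1 := hcS l hls
    have h2 : F l - y ⬝ᵥ l ≤ F a - y ⬝ᵥ a := hmin (by simp : a ∈ Metric.closedBall a 1)
    have h3 : (y - M a) ⬝ᵥ (l - a) ≤ ∑ i, |y i - M a i| := by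
      unfold dotProduct
      apply Finset.sum_le_sum
      intro i _
      have h4 : |(l - a) i| ≤ 1 := by
        have := norm_le_pi_norm (l - a) i
        rw [Metric.mem_sphere, dist_eq_norm] at hls
        rw [hls] at this
        exact this
      calc (y - M a) i * (l - a) i ≤ |(y - M a) i * (l - a) i| := le_abs_self _
        _ = |(y - M a) i| * |(l - a) i| := abs_mul _ _
        _ ≤ |(y - M a) i| * 1 := by gcongr
        _ = _ := by simp
    simp only [dotProduct_sub, sub_dotProduct] at h1 h3
    linarith
  refine ⟨l, ?_⟩
  have hloc : ∀ v : Fin r → ℝ, y ⬝ᵥ v ≤ M l ⬝ᵥ v := by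
    intro v
    have hcont : Continuous (fun t : ℝ => l + t • v) := by fun_prop
    have hlim : Filter.Tendsto (fun t : ℝ => M (l + t • v) ⬝ᵥ v) (nhdsWithin 0 (Set.Ioi 0))
        (nhds (M l ⬝ᵥ v)) := by
      have : Continuous (fun t : ℝ => M (l + t • v) ⬝ᵥ v) := by
        unfold dotProduct
        fun_prop
      have := this.tendsto 0
      simp only [zero_smul, add_zero] at this
      exact this.mono_left nhdsWithin_le_nhds
    apply ge_of_tendsto hlim
    have hev : ∀ᶠ t : ℝ in nhds 0, l + t • v ∈ Metric.ball a 1 := by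
      apply hcont.continuousAt.eventually_mem
      simpa using Metric.isOpen_ball.mem_nhds hlb
    filter_upwards [nhdsWithin_le_nhds hev, self_mem_nhdsWithin] with t ht ht0
    have ht0 : 0 < t := ht0
    have h2 : F l - y ⬝ᵥ l ≤ F (l + t • v) - y ⬝ᵥ (l + t • v) :=
      hmin (Metric.ball_subset_closedBall ht)
    have h3 : F (l + t • v) + M (l + t • v) ⬝ᵥ (l - (l + t • v)) ≤ F l := by
      by_cases he : l + t • v = l
      · rw [he]; simp
      · exact (h _ _ he).le
    have h4 : l - (l + t • v) = -(t • v) := by abel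
    rw [h4] at h3
    simp only [dotProduct_add, dotProduct_neg, dotProduct_smul, smul_eq_mul] at h2 h3
    exact le_of_mul_le_mul_left (by linarith) ht0
  have h5 := hloc (y - M l)
  have h6 : (y - M l) ⬝ᵥ (y - M l) ≤ 0 := by
    rw [sub_dotProduct]; linarith
  have h7 : (y - M l) ⬝ᵥ (y - M l) = 0 := by
    refine le_antisymm h6 ?_
    unfold dotProduct
    exact Finset.sum_nonneg fun i _ => mul_self_nonneg _
  rw [dotProduct_self_eq_zero] at h7
  exact (sub_eq_zero.mp h7).symm

instance aux_fin : IsFiniteMeasure sphereMeasure := by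
  unfold sphereMeasure; infer_instance

lemma aux_int (f : S2 → ℝ) (hf : Continuous f) : Integrable f sphereMeasure :=
  hf.integrable_of_hasCompactSupport (HasCompactSupport.of_compactSpace f)

lemma aux_cont {r : ℕ} (f : (Fin r → ℝ) → S2 → ℝ) (hf : Continuous (Function.uncurry f)) :
    Continuous (fun l => ∫ Ω, f l Ω ∂sphereMeasure) := by
  have := continuous_parametric_integral_of_continuous (μ := sphereMeasure) hf
    (isCompact_univ (X := S2))
  simpa using this

lemma aux_pos : sphereMeasure ≠ 0 := by
  unfold sphereMeasure
  intro h0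
  have := (volume : Measure (EuclideanSpace ℝ (Fin 3))).toSphere_apply_univ
  rw [h0] at this
  have hb := Metric.measure_ball_pos (volume : Measure (EuclideanSpace ℝ (Fin 3))) 0 one_pos
  simp at this
  linarith [Real.pi_pos]

lemma aux_F (r : ℕ) (K : ℕ) (hK : Odd K) (hKpos : 0 < K)
    (m : Fin r → S2 → ℝ) (hm : ∀ i, Continuous (m i))
    (hindep : ∀ b : Fin r → ℝ, b ≠ 0 →
      sphereMeasure {Ω : S2 | ∑ i, b i * m i Ω = 0} = 0) (a b : Fin r → ℝ) (hab : a ≠ b) :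
    (∫ Ω, (K / (K + 1) : ℝ) * (1 + (∑ j, a j * m j Ω) / (K : ℝ)) ^ (K + 1) ∂sphereMeasure)
      + momentMap r K m a ⬝ᵥ (b - a) <
    ∫ Ω, (K / (K + 1) : ℝ) * (1 + (∑ j, b j * m j Ω) / (K : ℝ)) ^ (K + 1) ∂sphereMeasure := by
  have hK0 : (0:ℝ) < K := by exact_mod_cast hKpos
  have e1 : momentMap r K m a ⬝ᵥ (b - a) = ∫ Ω, (∑ j, (b - a) j * m j Ω) *
      (1 + (∑ j, a j * m j Ω) / (K : ℝ)) ^ K ∂sphereMeasure := by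
    simp only [dotProduct, momentMap, Finset.sum_mul]
    rw [integral_finsetSum _ (fun i _ => aux_int _ (by fun_prop))]
    refine Finset.sum_congr rfl fun i _ => ?_
    rw [← integral_mul_const]
    congr 1
    ext Ω
    ring
  rw [e1, ← integral_add (aux_int _ (by fun_prop)) (aux_int _ (by fun_prop)), ← sub_pos,
    ← integral_sub (aux_int _ (by fun_prop)) (aux_int _ (by fun_prop))]
  have hpt : ∀ Ω : S2, (∑ j, (b - a) j * m j Ω) ≠ 0 →
      0 < (K / (K + 1) : ℝ) * (1 + (∑ j, b j * m j Ω) / (K : ℝ)) ^ (K + 1) -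
      ((K / (K + 1) : ℝ) * (1 + (∑ j, a j * m j Ω) / (K : ℝ)) ^ (K + 1) +
        (∑ j, (b - a) j * m j Ω) * (1 + (∑ j, a j * m j Ω) / (K : ℝ)) ^ K) := by
    intro Ω hΩ
    have e2 : ∑ j, (b - a) j * m j Ω = ∑ j, b j * m j Ω - ∑ j, a j * m j Ω := by
      simp [sub_mul, Finset.sum_sub_distrib]
    rw [e2] at hΩ ⊢
    set p := ∑ j, b j * m j Ω
    set q := ∑ j, a j * m j Ω
    have hne : 1 + q / (K:ℝ) ≠ 1 + p / (K:ℝ) := by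
      intro he
      apply hΩ
      field_simp at he
      linarith
    have := aux_pow K hK _ _ hne
    have e3 : p - q = K * ((1 + p / (K:ℝ)) - (1 + q / (K:ℝ))) := by
      field_simp; ring
    rw [e3]
    have e4 := mul_lt_mul_of_pos_left this (show (0:ℝ) < K / (K+1) by positivity)
    have e5 : (K / (K+1) : ℝ) * (((K:ℝ) + 1) * (1 + q / (K:ℝ)) ^ K * (1 + p / (K:ℝ) - (1 + q / (K:ℝ))))
      = K * (1 + p / (K:ℝ) - (1 + q / (K:ℝ))) * (1 + q / (K:ℝ)) ^ K := by
      have : (K / (K+1) : ℝ) * ((K:ℝ) + 1) = K := by field_simp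
      linear_combination ((1 + q / (K:ℝ)) ^ K * (1 + p / (K:ℝ) - (1 + q / (K:ℝ)))) * this
    rw [e5] at e4
    linarith
  have hae : ∀ᵐ Ω ∂sphereMeasure, (∑ j, (b - a) j * m j Ω) ≠ 0 := by
    rw [ae_iff]
    simpa only [ne_eq, not_not] using hindep (b - a) (sub_ne_zero.mpr (Ne.symm hab))
  rw [integral_pos_iff_support_of_nonneg_ae]
  · rw [pos_iff_ne_zero]
    intro h0
    have h1 : ∀ᵐ Ω ∂sphereMeasure, False := by
      have := measure_eq_zero_iff_ae_notMem.mp h0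
      filter_upwards [this, hae] with Ω h2 h3
      exact h2 (hpt Ω h3).ne'
    rw [Filter.eventually_false_iff_eq_bot, ae_eq_bot] at h1
    exact aux_pos h1
  · filter_upwards [hae] with Ω h3
    exact (hpt Ω h3).le
  · exact aux_int _ (by fun_prop)

/-- the moment map of the `β_K` closure is continuous and injective,
and consequently (by Brouwer's invariance of domain) its range is open in `ℝ^r`. -/
theorem momentMap_continuous_injective_openRange (r : ℕ) (hr : 1 ≤ r)
    (K : ℕ) (hK : Odd K) (hKpos : 0 < K)
    (m : Fin r → S2 → ℝ) (hm : ∀ i, Continuous (m i))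
    (hindep : ∀ b : Fin r → ℝ, b ≠ 0 →
      sphereMeasure {Ω : S2 | ∑ i, b i * m i Ω = 0} = 0) :
    Continuous (momentMap r K m) ∧ Function.Injective (momentMap r K m) ∧
      IsOpen (Set.range (momentMap r K m)) := by
  have hM : Continuous (momentMap r K m) := by
    refine continuous_pi fun i => ?_
    unfold momentMap
    apply aux_cont
    unfold Function.uncurry
    fun_prop
  have hF := aux_F r K hK hKpos m hm hindep
  refine ⟨hM, aux_inj _ _ hF, aux_open _ _ ?_ hM hF⟩
  apply aux_cont
  unfold Function.uncurry
  fun_prop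
end

section
/- Let r ≥ 1, let K be an odd positive integer, let σ > 0, let m₁, …, m_r : S² → ℝ be continuous, and let λ ∈ ℝ^r. Then the r×r matrix J with entries J_{ab} = −(σ/(8π))·∫_{S²}∫_{S²} (m_a(Ω') − m_a(Ω))·(m_b(Ω') − m_b(Ω))·(1 + (λ·m(Ω))/K)^{K−1} dΩ dΩ' is symmetric and negative semidefinite. Moreover, if (1 + (λ·m(Ω))/K)^{K−1} > 0 for all Ω ∈ S², then for any V ∈ ℝ^r, VᵀJV = 0 holds if and only if the function V·m is constant on S². -/
open MeasureTheory Metric Matrix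

instance : IsFiniteMeasure sphereMeasure := by unfold sphereMeasure; infer_instance

instance : sphereMeasure.IsOpenPosMeasure := by unfold sphereMeasure; infer_instance

lemma s2_integrable {g : S2 → ℝ} (hg : Continuous g) : Integrable g sphereMeasure :=
  hg.integrable_of_hasCompactSupport (HasCompactSupport.of_compactSpace g)

lemma s2_cont_inner {F : S2 → S2 → ℝ} (hF : Continuous F.uncurry) :
    Continuous fun x => ∫ y, F x y ∂sphereMeasure := by
  have := continuous_parametric_integral_of_continuous (μ := sphereMeasure) hF isCompact_univ
  simpa using this

lemma s2_quad {r : ℕ} (c : ℝ) (m : Fin r → S2 → ℝ) (hm : ∀ i, Continuous (m i)) (w : S2 → ℝ)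
    (hw : Continuous w) (V : Fin r → ℝ) :
    V ⬝ᵥ (Matrix.of fun a b => c * ∫ Ω', ∫ Ω,
      (m a Ω' - m a Ω) * (m b Ω' - m b Ω) * w Ω ∂sphereMeasure ∂sphereMeasure) *ᵥ V
    = c * ∫ Ω', ∫ Ω, (∑ i, V i * m i Ω' - ∑ i, V i * m i Ω) ^ 2 * w Ω
        ∂sphereMeasure ∂sphereMeasure := by
  have key : ∀ Ω' Ω, (∑ i, V i * m i Ω' - ∑ i, V i * m i Ω) ^ 2 * w Ω
      = ∑ a, ∑ b, V a * V b * ((m a Ω' - m a Ω) * (m b Ω' - m b Ω) * w Ω) := by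
    intro Ω' Ω
    rw [← Finset.sum_sub_distrib, sq, Finset.sum_mul_sum, Finset.sum_mul]
    refine Finset.sum_congr rfl fun a _ => ?_
    rw [Finset.sum_mul]
    refine Finset.sum_congr rfl fun b _ => ?_
    ring
  have hc : ∀ a b, Continuous (Function.uncurry fun Ω' Ω =>
      (m a Ω' - m a Ω) * (m b Ω' - m b Ω) * w Ω) := by
    intro a b
    have := hm a
    have := hm b
    simp only [Function.uncurry_def]
    fun_prop
  have hi : ∀ a b Ω', Integrable (fun Ω =>
      V a * V b * ((m a Ω' - m a Ω) * (m b Ω' - m b Ω) * w Ω)) sphereMeasure := by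
    intro a b Ω'
    have := hm a
    have := hm b
    apply s2_integrable
    fun_prop
  have ho : ∀ a b, Integrable (fun Ω' => V a * V b * ∫ Ω,
      (m a Ω' - m a Ω) * (m b Ω' - m b Ω) * w Ω ∂sphereMeasure) sphereMeasure := fun a b =>
    (s2_integrable (s2_cont_inner (hc a b))).const_mul _
  have e1 : ∀ Ω', ∫ Ω, (∑ i, V i * m i Ω' - ∑ i, V i * m i Ω) ^ 2 * w Ω ∂sphereMeasure
      = ∑ a, ∑ b, V a * V b *
        ∫ Ω, (m a Ω' - m a Ω) * (m b Ω' - m b Ω) * w Ω ∂sphereMeasure := by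
    intro Ω'
    simp_rw [key]
    rw [integral_finsetSum _ fun a _ => integrable_finsetSum _ fun b _ => hi a b Ω']
    refine Finset.sum_congr rfl fun a _ => ?_
    rw [integral_finsetSum _ fun b _ => hi a b Ω']
    simp_rw [integral_const_mul]
  simp_rw [e1]
  rw [integral_finsetSum _ fun a _ => integrable_finsetSum _ fun b _ => ho a b, Finset.mul_sum]
  simp only [dotProduct, mulVec, of_apply]
  refine Finset.sum_congr rfl fun a _ => ?_
  rw [integral_finsetSum _ fun b _ => ho a b, Finset.mul_sum, Finset.mul_sum]
  refine Finset.sum_congr rfl fun b _ => ?_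
  rw [integral_const_mul]
  ring

/-- the linearization of the moment-level collision term,
`J_{ab} = −(σ/(8π))·∫∫ (m_a(Ω')−m_a(Ω))·(m_b(Ω')−m_b(Ω))·(1+(λ·m(Ω))/K)^{K−1} dΩ dΩ'`,
is symmetric and negative semidefinite; moreover, if the weight
`(1+(λ·m(Ω))/K)^{K−1}` is everywhere positive, then `VᵀJV = 0` iff the function `V·m`
is constant on `S²`. -/
theorem collision_linearization_negSemidef (r : ℕ) (hr : 1 ≤ r)
    (K : ℕ) (hK : Odd K) (hKpos : 0 < K) (σ : ℝ) (hσ : 0 < σ)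
    (m : Fin r → S2 → ℝ) (hm : ∀ i, Continuous (m i)) (lam : Fin r → ℝ) :
    let J : Matrix (Fin r) (Fin r) ℝ := Matrix.of fun a b =>
      -(σ / (8 * Real.pi)) * ∫ Ω', ∫ Ω,
        (m a Ω' - m a Ω) * (m b Ω' - m b Ω) *
          (1 + (∑ i, lam i * m i Ω) / (K : ℝ)) ^ (K - 1) ∂sphereMeasure ∂sphereMeasure
    J.IsSymm ∧ (∀ V : Fin r → ℝ, V ⬝ᵥ J *ᵥ V ≤ 0) ∧
      ((∀ Ω : S2, 0 < (1 + (∑ i, lam i * m i Ω) / (K : ℝ)) ^ (K - 1)) →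
        ∀ V : Fin r → ℝ, V ⬝ᵥ J *ᵥ V = 0 ↔ ∃ c : ℝ, ∀ Ω : S2, ∑ i, V i * m i Ω = c) := by
  intro J
  have hw : Continuous fun Ω : S2 => (1 + (∑ i, lam i * m i Ω) / (K : ℝ)) ^ (K - 1) := by
    fun_prop
  have hw0 : ∀ Ω : S2, 0 ≤ (1 + (∑ i, lam i * m i Ω) / (K : ℝ)) ^ (K - 1) := fun Ω =>
    (Nat.Odd.sub_odd hK odd_one).pow_nonneg _
  have hc : 0 < σ / (8 * Real.pi) := by positivity
  have hq := s2_quad (-(σ / (8 * Real.pi))) m hm _ hw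
  refine ⟨?_, ?_, ?_⟩
  · ext a b
    simp only [J, transpose_apply, of_apply]
    simp_rw [mul_comm (m b _ - m b _)]
  · intro V
    rw [hq V]
    have : 0 ≤ ∫ Ω', ∫ Ω, (∑ i, V i * m i Ω' - ∑ i, V i * m i Ω) ^ 2 *
        (1 + (∑ i, lam i * m i Ω) / (K : ℝ)) ^ (K - 1) ∂sphereMeasure ∂sphereMeasure :=
      integral_nonneg fun x => integral_nonneg fun y => mul_nonneg (sq_nonneg _) (hw0 y)
    nlinarith
  · intro hpos V
    rw [hq V]
    constructor
    · intro h
      have hF : Continuous (Function.uncurry fun Ω' Ω : S2 =>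
          (∑ i, V i * m i Ω' - ∑ i, V i * m i Ω) ^ 2 *
            (1 + (∑ i, lam i * m i Ω) / (K : ℝ)) ^ (K - 1)) := by
        simp only [Function.uncurry_def]
        fun_prop
      have hFn : ∀ Ω' Ω : S2, 0 ≤ (∑ i, V i * m i Ω' - ∑ i, V i * m i Ω) ^ 2 *
            (1 + (∑ i, lam i * m i Ω) / (K : ℝ)) ^ (K - 1) := fun x y =>
        mul_nonneg (sq_nonneg _) (hw0 y)
      have h0 := (mul_eq_zero.1 h).resolve_left (by linarith)
      by_contra! hne
      obtain ⟨x, hx⟩ : ∃ x : S2, True := by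
        obtain ⟨x, hx⟩ := (NormedSpace.sphere_nonempty (E := EuclideanSpace ℝ (Fin 3))
          (x := 0) (r := 1)).2 zero_le_one
        exact ⟨⟨x, hx⟩, trivial⟩
      obtain ⟨y, hy⟩ := hne (∑ i, V i * m i x)
      have h1 : 0 < ∫ Ω, (∑ i, V i * m i x - ∑ i, V i * m i Ω) ^ 2 *
            (1 + (∑ i, lam i * m i Ω) / (K : ℝ)) ^ (K - 1) ∂sphereMeasure := by
        refine Continuous.integral_pos_of_hasCompactSupport_nonneg_nonzero (x := y)
          (by fun_prop) (HasCompactSupport.of_compactSpace _) (hFn x) ?_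
        exact mul_ne_zero (pow_ne_zero _ (sub_ne_zero.2 hy.symm)) (hpos y).ne'
      have h2 := Continuous.integral_pos_of_hasCompactSupport_nonneg_nonzero
        (μ := sphereMeasure) (x := x) (s2_cont_inner hF) (HasCompactSupport.of_compactSpace _)
        (fun z => integral_nonneg (hFn z)) h1.ne'
      exact h2.ne' h0
    · rintro ⟨c, hc⟩
      simp [hc]
end

section
/- Let r ≥ 1, let K be an odd positive integer, and let m₁, …, m_r : S² → ℝ be continuous. Suppose the constant function 1 lies in the span of m₁, …, m_r and that there is C > 0 with ‖λ‖ ≤ C·‖λ·m‖_{L²(S²)} for all λ ∈ ℝ^r. Then for every λ ∈ ℝ^r there exists λ' ∈ ℝ^r with λ'·m = 1 + (λ·m)/K, and for this λ' the moment vector ρ = M(λ), with M(λ)ᵢ = ∫_{S²} mᵢ(Ω)·(1 + (λ·m(Ω))/K)^K dΩ, satisfies λ'·ρ = ∫_{S²} (1 + (λ·m(Ω))/K)^{K+1} dΩ = ‖1 + (λ·m)/K‖_{L^{K+1}(S²)}^{K+1} ≥ 0. -/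
open MeasureTheory Metric Matrix

/-- the key computation in the coercivity lemma: if the span of the
`mᵢ` contains the constant `1` (and the euclidean norm is controlled by the `L²` norm
of `λ·m`), then for every `λ` there is `λ'` with `λ'·m = 1 + (λ·m)/K`, and for this
`λ'` the moment vector `ρ = M(λ)` satisfies
`λ'·ρ = ∫_{S²} (1 + (λ·m)/K)^{K+1} dΩ = ‖1 + (λ·m)/K‖_{L^{K+1}}^{K+1} ≥ 0`. -/
theorem coercivity_key_identity (r : ℕ) (hr : 1 ≤ r)
    (K : ℕ) (hK : Odd K) (hKpos : 0 < K)
    (m : Fin r → S2 → ℝ) (hm : ∀ i, Continuous (m i))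
    (hone : ∃ c : Fin r → ℝ, ∀ Ω : S2, ∑ i, c i * m i Ω = 1)
    (C : ℝ) (hC : 0 < C)
    (hbound : ∀ lam : EuclideanSpace ℝ (Fin r),
      ‖lam‖ ≤ C * Real.sqrt (∫ Ω, (∑ i, lam i * m i Ω) ^ 2 ∂sphereMeasure)) :
    ∀ lam : Fin r → ℝ, ∃ lam' : Fin r → ℝ,
      (∀ Ω : S2, ∑ i, lam' i * m i Ω = 1 + (∑ i, lam i * m i Ω) / (K : ℝ)) ∧
      lam' ⬝ᵥ momentMap r K m lam
        = ∫ Ω, (1 + (∑ i, lam i * m i Ω) / (K : ℝ)) ^ (K + 1) ∂sphereMeasure ∧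
      lam' ⬝ᵥ momentMap r K m lam
        = ∫ Ω, |1 + (∑ i, lam i * m i Ω) / (K : ℝ)| ^ (K + 1) ∂sphereMeasure ∧
      0 ≤ lam' ⬝ᵥ momentMap r K m lam := by
  intro lam
  obtain ⟨c, hc⟩ := hone
  haveI : IsFiniteMeasure sphereMeasure := by unfold sphereMeasure; infer_instance
  have h1 : ∀ Ω : S2, ∑ i, (c i + lam i / (K : ℝ)) * m i Ω
      = 1 + (∑ i, lam i * m i Ω) / (K : ℝ) := by
    intro Ω
    rw [← hc Ω, Finset.sum_div, ← Finset.sum_add_distrib]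
    exact Finset.sum_congr rfl fun i _ => by ring
  have hcont : Continuous fun Ω : S2 => 1 + (∑ i, lam i * m i Ω) / (K : ℝ) := by fun_prop
  have h2 : (fun i => c i + lam i / (K : ℝ)) ⬝ᵥ momentMap r K m lam
      = ∫ Ω, (1 + (∑ i, lam i * m i Ω) / (K : ℝ)) ^ (K + 1) ∂sphereMeasure := by
    simp only [dotProduct, momentMap]
    simp_rw [← integral_const_mul]
    rw [← integral_finsetSum]
    · refine integral_congr_ae (Filter.Eventually.of_forall fun Ω => ?_)
      simp only
      rw [pow_succ', ← h1 Ω, Finset.sum_mul]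
      exact Finset.sum_congr rfl fun i _ => by ring
    · intro i _
      have hc2 : Continuous fun Ω : S2 => (c i + lam i / (K : ℝ)) *
          (m i Ω * (1 + (∑ j, lam j * m j Ω) / (K : ℝ)) ^ K) :=
        continuous_const.mul ((hm i).mul (hcont.pow K))
      exact hc2.integrable_of_hasCompactSupport (HasCompactSupport.of_compactSpace _)
  have hev : Even (K + 1) := hK.add_one
  refine ⟨_, h1, h2, ?_, ?_⟩
  · rw [h2]
    simp_rw [hev.pow_abs]
  · rw [h2]
    exact integral_nonneg fun Ω => hev.pow_nonneg _
end
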